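/- Fermionic anticommutator formula (Theorem 3.2, odd case, discrete-mode form): for all n_A, m_A, n_B, m_B ∈ ℕ with (n_A + m_A)·(n_B + m_B) odd, and all finitely supported kernels f_A : (Fin n_A → ι) × (Fin m_A → ι) → ℂ and f_B : (Fin n_B → ι) × (Fin m_B → ι) → ℂ, one has Op(f_A) * Op(f_B) + Op(f_B) * Op(f_A) = Op(f_A) Γ₋ Op(f_B) + Op(f_B) Γ₋ Op(f_A), where Op(f_B) Γ₋ Op(f_A) is the fermionic attached product with the roles of A and B interchanged (sum over 𝒞(m_B, n_A) with signs sgn(π,π',m_B,n_A)). -/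

import Mathlib

open scoped Classical

noncomputable section

/-- The unique permutation `σ` of `Fin n` taking the contraction `π` into maximally
crossed form: `σ (π c)` has value `n − 1 − c` (i.e. `σ` sends the `c`-th contracted
connector to the `c`-th top-most position), and `σ` is strictly increasing on the
complement of the range of `π`.  (Defined by choice; for injective `π` such a
permutation exists and is unique.) -/
def maxCrossPerm {n C : ℕ} (π : Fin C → Fin n) : Equiv.Perm (Fin n) :=
  if h : ∃ σ : Equiv.Perm (Fin n),
      (∀ c : Fin C, ((σ (π c) : Fin n) : ℕ) = n - 1 - (c : ℕ)) ∧
      ∀ u₁ u₂ : Fin n, u₁ ∉ Set.range π → u₂ ∉ Set.range π → u₁ < u₂ → σ u₁ < σ u₂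
  then h.choose else 1

/-- The sign `sgn(π, π', m, n) = (−1)^{(m−C)(n−C)} · sign σ · sign σ'` of a contraction
configuration. -/
def configSign {m n C : ℕ} (π : Fin C → Fin n) (π' : Fin C → Fin m) : ℤ :=
  (-1) ^ ((m - C) * (n - C)) *
    ((Equiv.Perm.sign (maxCrossPerm π) : ℤˣ) : ℤ) *
    ((Equiv.Perm.sign (maxCrossPerm π') : ℤˣ) : ℤ)

variable {ι : Type*} [DecidableEq ι] {R : Type*} [Ring R] [Algebra ℂ R]

/-- `FOp a adag f` is the normal ordered operator
`Σ_{(X,Y)} f(X,Y) · a⁺_{X n} ⋯ a⁺_{X 1} · a_{Y 1} ⋯ a_{Y m}` associated with a finitely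
supported kernel `f`. -/
def FOp (a adag : ι → R) {n m : ℕ} (f : ((Fin n → ι) × (Fin m → ι)) →₀ ℂ) : R :=
  f.sum fun XY c =>
    c • ((List.ofFn fun i => adag (XY.1 i)).reverse.prod *
         (List.ofFn fun j => a (XY.2 j)).prod)

/-- The fermionic attached product `Op(f_A) Γ₋ Op(f_B)`: a signed sum over all contraction
configurations `(π, π')`, where `π` (strictly decreasing) picks left connectors of `B`
and `π'` (injective) picks right connectors of `A`. Uncontracted connectors keep their
order (contracted ones are replaced by the unit `1` inside the ordered products). -/
def FAttachF (a adag : ι → R) {nA mA nB mB : ℕ}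
    (fA : ((Fin nA → ι) × (Fin mA → ι)) →₀ ℂ)
    (fB : ((Fin nB → ι) × (Fin mB → ι)) →₀ ℂ) : R :=
  ∑ C ∈ Finset.Icc 1 (min mA nB),
    ∑ π ∈ Finset.univ.filter (fun π : Fin C → Fin nB => StrictAnti π),
      ∑ π' ∈ Finset.univ.filter (fun π' : Fin C → Fin mA => Function.Injective π'),
        fA.sum fun XYA cA => fB.sum fun XYB cB =>
          ((configSign π π' : ℂ) * cA * cB *
              ∏ c : Fin C, if XYB.1 (π c) = XYA.2 (π' c) then (1 : ℂ) else 0) •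
            ((List.ofFn fun i => adag (XYA.1 i)).reverse.prod *
             (List.ofFn fun i : Fin nB =>
                if ∃ c, π c = i then (1 : R) else adag (XYB.1 i)).reverse.prod *
             (List.ofFn fun j : Fin mA =>
                if ∃ c, π' c = j then (1 : R) else a (XYA.2 j)).prod *
             (List.ofFn fun j => a (XYB.2 j)).prod)

/-- `σ` brings the contraction `π` into maximally crossed form: this is the property
characterising `maxCrossPerm π`. -/
def IsMaxCross {n C : ℕ} (π : Fin C → Fin n) (σ : Equiv.Perm (Fin n)) : Prop :=
  (∀ c : Fin C, ((σ (π c) : Fin n) : ℕ) = n - 1 - (c : ℕ)) ∧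
    ∀ u₁ u₂ : Fin n, u₁ ∉ Set.range π → u₂ ∉ Set.range π → u₁ < u₂ → σ u₁ < σ u₂

theorem IsMaxCross.unique {n C : ℕ} {π : Fin C → Fin n} (hπ : Function.Injective π)
    {σ τ : Equiv.Perm (Fin n)} (hσ : IsMaxCross π σ) (hτ : IsMaxCross π τ) : σ = τ := by
  have hC : C ≤ n := by simpa using Fintype.card_le_of_injective π hπ
  have high : ∀ v : Fin n, n - C ≤ (v : ℕ) → τ (σ.symm v) = v := by
    intro v hv
    have hlt : n - 1 - (v : ℕ) < C := by omega
    have h1 : σ (π ⟨n - 1 - v, hlt⟩) = v := by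
      ext; rw [hσ.1]; simp only; omega
    have h2 : τ (π ⟨n - 1 - v, hlt⟩) = v := by
      ext; rw [hτ.1]; simp only; omega
    rw [← h1, Equiv.symm_apply_apply, h2, h1]
  have notMem : ∀ v : Fin n, (v : ℕ) < n - C → σ.symm v ∉ Set.range π := by
    rintro v hv ⟨c, hc⟩
    have := hσ.1 c
    rw [hc, Equiv.apply_symm_apply] at this
    have := c.2
    omega
  have low : ∀ v : Fin n, (v : ℕ) < n - C → (τ (σ.symm v) : ℕ) < n - C := by
    intro v hv
    by_contra! h
    have := high _ h
    have := σ.symm.injective (τ.injective this)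
    rw [this] at h
    omega
  have mono : StrictMono (σ.symm.trans τ) := by
    intro u v huv
    have huv' : (u : ℕ) < v := huv
    simp only [Equiv.trans_apply]
    rcases lt_or_ge (v : ℕ) (n - C) with hv | hv
    · refine hτ.2 _ _ (notMem u (by omega)) (notMem v hv) ?_
      rcases lt_trichotomy (σ.symm u) (σ.symm v) with h | h | h
      · exact h
      · exact absurd (σ.symm.injective h) huv.ne
      · have := hσ.2 _ _ (notMem v hv) (notMem u (by omega)) h
        simp only [Equiv.apply_symm_apply] at this
        exact absurd this huv.not_gt
    · rw [high v hv]
      rcases lt_or_ge (u : ℕ) (n - C) with hu | hu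
      · exact Fin.lt_def.2 (by have := low u hu; omega)
      · rwa [high u hu]
  have key : ∀ v, (σ.symm.trans τ) v = v := fun v =>
    congrArg (fun e : Fin n ≃o Fin n => e v)
      (Subsingleton.elim (mono.orderIsoOfSurjective _ (σ.symm.trans τ).surjective)
        (OrderIso.refl _))
  ext u
  have := key (σ u)
  simp only [Equiv.trans_apply, Equiv.symm_apply_apply] at this
  rw [this]

theorem maxCrossPerm_eq {n C : ℕ} {π : Fin C → Fin n} (hπ : Function.Injective π)
    {σ : Equiv.Perm (Fin n)} (hσ : IsMaxCross π σ) : maxCrossPerm π = σ := by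
  have h : ∃ σ, IsMaxCross π σ := ⟨σ, hσ⟩
  have : maxCrossPerm π = h.choose := dif_pos h
  rw [this]
  exact h.choose_spec.unique hπ hσ

/-- The permutation of `Fin (n + 1)` sending `j` to the last position and acting as `σ` on the
remaining positions, both before and after removal of the distinguished one. -/
def pullToLast {n : ℕ} (j : Fin (n + 1)) (σ : Equiv.Perm (Fin n)) : Equiv.Perm (Fin (n + 1)) :=
  (finSuccEquiv' j).trans (σ.optionCongr.trans (finSuccEquiv' (Fin.last n)).symm)

theorem pullToLast_self {n : ℕ} (j : Fin (n + 1)) (σ : Equiv.Perm (Fin n)) :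
    pullToLast j σ j = Fin.last n := by
  simp [pullToLast]

theorem pullToLast_succAbove {n : ℕ} (j : Fin (n + 1)) (σ : Equiv.Perm (Fin n)) (i : Fin n) :
    pullToLast j σ (j.succAbove i) = (σ i).castSucc := by
  simp [pullToLast]

theorem sign_pullToLast {n : ℕ} (j : Fin (n + 1)) (σ : Equiv.Perm (Fin n)) :
    Equiv.Perm.sign (pullToLast j σ) = (-1) ^ (n + (j : ℕ)) * Equiv.Perm.sign σ := by
  have h : pullToLast j σ = ((finSuccEquiv' 0).trans (σ.optionCongr.trans (finSuccEquiv' 0).symm)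
      |>.trans (Fin.cycleRange (Fin.last n)).symm) * j.cycleRange := by
    ext u
    cases u using Fin.succAboveCases j with
    | x => simp [pullToLast]
    | p i =>
      have h₀ : finSuccEquiv' (0 : Fin (n + 1)) i.succ = some i := by
        simp
      have h₁ : (Fin.last n).cycleRange.symm (σ i).succ = (σ i).castSucc := by
        rw [Fin.cycleRange_symm_succ, Fin.succAbove_last]
      simp [pullToLast, h₀, h₁, -Fin.cycleRange_last]
  rw [h, Equiv.Perm.sign_mul, Fin.sign_cycleRange, Equiv.Perm.sign_trans, ← Equiv.trans_assoc,
    Equiv.Perm.sign_trans_trans_symm, Equiv.optionCongr_sign, Equiv.Perm.sign_symm,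
    Fin.sign_cycleRange]
  rw [Fin.val_last, pow_add]
  ac_rfl

theorem IsMaxCross.cons {n C : ℕ} {π : Fin C → Fin n} (j : Fin (n + 1))
    {σ : Equiv.Perm (Fin n)} (hσ : IsMaxCross π σ) :
    IsMaxCross (Fin.cons j (j.succAbove ∘ π) : Fin (C + 1) → Fin (n + 1)) (pullToLast j σ) := by
  refine ⟨fun c => ?_, fun u₁ u₂ h₁ h₂ h => ?_⟩
  · cases c using Fin.cases with
    | zero => simp [pullToLast_self]
    | succ c => simp [pullToLast_succAbove, hσ.1]; omega
  · simp only [Fin.range_cons, Set.mem_insert_iff, not_or] at h₁ h₂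
    obtain ⟨i₁, rfl⟩ := Fin.exists_succAbove_eq h₁.1
    obtain ⟨i₂, rfl⟩ := Fin.exists_succAbove_eq h₂.1
    rw [pullToLast_succAbove, pullToLast_succAbove, Fin.castSucc_lt_castSucc_iff]
    refine hσ.2 _ _ ?_ ?_ (Fin.succAbove_lt_succAbove_iff.1 h)
    · rintro ⟨c, rfl⟩; exact h₁.2 ⟨c, rfl⟩
    · rintro ⟨c, rfl⟩; exact h₂.2 ⟨c, rfl⟩

theorem exists_eq_cons_succAbove {n C : ℕ} {π : Fin (C + 1) → Fin (n + 1)}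
    (hπ : Function.Injective π) :
    ∃ (j : Fin (n + 1)) (ρ : Fin C → Fin n), Function.Injective ρ ∧
      π = Fin.cons j (j.succAbove ∘ ρ) := by
  have h : ∀ c : Fin C, ∃ i, (π 0).succAbove i = π c.succ := fun c =>
    Fin.exists_succAbove_eq (hπ.ne (Fin.succ_ne_zero c))
  choose ρ hρ using h
  refine ⟨π 0, ρ, fun c d hcd => ?_, ?_⟩
  · have := hρ c
    rw [hcd, hρ d] at this
    exact (Fin.succ_injective _ (hπ this)).symm
  · ext c
    cases c using Fin.cases with
    | zero => rfl
    | succ c => simp [hρ]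

theorem injective_cons_succAbove {n C : ℕ} {ρ : Fin C → Fin n} (j : Fin (n + 1))
    (hρ : Function.Injective ρ) :
    Function.Injective (Fin.cons j (j.succAbove ∘ ρ) : Fin (C + 1) → Fin (n + 1)) := by
  rw [Fin.cons_injective_iff]
  refine ⟨?_, Fin.succAbove_right_injective.comp hρ⟩
  rintro ⟨c, hc⟩
  exact Fin.succAbove_ne j _ hc

theorem isMaxCross_one {n : ℕ} (π : Fin 0 → Fin n) : IsMaxCross π 1 :=
  ⟨fun c => c.elim0, fun _ _ _ _ h => h⟩

theorem exists_isMaxCross {C : ℕ} : ∀ {n : ℕ} {π : Fin C → Fin n}, Function.Injective π →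
    ∃ σ, IsMaxCross π σ := by
  induction C with
  | zero => exact fun _ => ⟨1, isMaxCross_one _⟩
  | succ C ih =>
    intro n π hπ
    cases n with
    | zero => exact (π 0).elim0
    | succ n =>
      obtain ⟨j, ρ, hρ, rfl⟩ := exists_eq_cons_succAbove hπ
      obtain ⟨σ, hσ⟩ := ih hρ
      exact ⟨_, hσ.cons j⟩

theorem sign_maxCrossPerm_cons {n C : ℕ} {π : Fin C → Fin n} (hπ : Function.Injective π)
    (j : Fin (n + 1)) :
    Equiv.Perm.sign (maxCrossPerm
      (Fin.cons j (j.succAbove ∘ π) : Fin (C + 1) → Fin (n + 1))) =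
      (-1) ^ (n + (j : ℕ)) * Equiv.Perm.sign (maxCrossPerm π) := by
  obtain ⟨σ, hσ⟩ := exists_isMaxCross hπ
  rw [maxCrossPerm_eq (injective_cons_succAbove j hπ) (hσ.cons j), maxCrossPerm_eq hπ hσ,
    sign_pullToLast]

theorem maxCrossPerm_zero {n : ℕ} (π : Fin 0 → Fin n) : maxCrossPerm π = 1 :=
  maxCrossPerm_eq (Function.injective_of_subsingleton π) (isMaxCross_one π)

theorem sign_maxCrossPerm_castSucc {C : ℕ} : ∀ {n : ℕ} {π : Fin C → Fin n},
    Function.Injective π → Equiv.Perm.sign (maxCrossPerm (Fin.castSucc ∘ π)) =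
      (-1) ^ C * Equiv.Perm.sign (maxCrossPerm π) := by
  induction C with
  | zero => intro n π _; simp [maxCrossPerm_zero]
  | succ C ih =>
    intro n π hπ
    cases n with
    | zero => exact (π 0).elim0
    | succ n =>
      obtain ⟨j, ρ, hρ, rfl⟩ := exists_eq_cons_succAbove hπ
      have h : Fin.castSucc ∘ (Fin.cons j (j.succAbove ∘ ρ) : Fin (C + 1) → Fin (n + 1)) =
          Fin.cons j.castSucc (j.castSucc.succAbove ∘ (Fin.castSucc ∘ ρ)) := by
        ext c
        cases c using Fin.cases with
        | zero => rfl
        | succ c => simp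
      rw [h, sign_maxCrossPerm_cons ((Fin.castSucc_injective n).comp hρ), ih hρ,
        sign_maxCrossPerm_cons hρ]
      have key : ∀ x y z s : ℤˣ, x * z * (y * s) = y * z * (x * s) := fun x y z s => by ac_rfl
      rw [Fin.val_castSucc, add_right_comm, pow_succ, pow_succ]
      exact key _ _ _ _

theorem configSign_castSucc {m n C : ℕ} {π : Fin C → Fin n} {π' : Fin C → Fin m}
    (hπ : Function.Injective π) (hπ' : Function.Injective π') :
    configSign (Fin.castSucc ∘ π) π' = (-1) ^ m * configSign π π' := by
  have hn : C ≤ n := by simpa using Fintype.card_le_of_injective π hπ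
  have hm : C ≤ m := by simpa using Fintype.card_le_of_injective π' hπ'
  obtain ⟨k, rfl⟩ := Nat.exists_eq_add_of_le hn
  obtain ⟨l, rfl⟩ := Nat.exists_eq_add_of_le hm
  rw [configSign, configSign, sign_maxCrossPerm_castSucc hπ]
  have : C + k + 1 - C = k + 1 := by omega
  simp only [this, Nat.add_sub_cancel_left, Units.val_mul, Units.val_pow_eq_pow_val, Units.val_neg,
    Units.val_one, pow_add, mul_add, mul_one]
  ring

theorem configSign_cons {m n C : ℕ} {π : Fin C → Fin n} {π' : Fin C → Fin m}
    (hπ : Function.Injective π) (hπ' : Function.Injective π') (j : Fin (m + 1)) :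
    configSign (Fin.cons (Fin.last n) (Fin.castSucc ∘ π) : Fin (C + 1) → Fin (n + 1))
      (Fin.cons j (j.succAbove ∘ π') : Fin (C + 1) → Fin (m + 1)) =
      (-1) ^ (m + (j : ℕ)) * configSign π π' := by
  have h := sign_maxCrossPerm_cons hπ (Fin.last n)
  rw [Fin.succAbove_last, Fin.val_last, ← two_mul, pow_mul, neg_one_sq, one_pow, one_mul] at h
  rw [configSign, configSign, h, sign_maxCrossPerm_cons hπ']
  simp only [Nat.add_sub_add_right, Units.val_mul, Units.val_pow_eq_pow_val, Units.val_neg,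
    Units.val_one]
  ring
theorem list_prod_ofFn_eq_of_apply_eq_one {M : Type*} [Monoid M] :
    ∀ {n : ℕ} (g : Fin (n + 1) → M) (j : Fin (n + 1)), g j = 1 →
      (List.ofFn g).prod = (List.ofFn (g ∘ j.succAbove)).prod := by
  intro n
  induction n with
  | zero =>
    intro g j hj
    obtain rfl : j = 0 := Fin.fin_one_eq_zero j
    simp [hj]
  | succ n ih =>
    intro g j hj
    rw [List.ofFn_succ, List.prod_cons]
    cases j using Fin.cases with
    | zero => rw [hj, one_mul]; rfl
    | succ j =>
      rw [ih (fun i => g i.succ) j hj, List.ofFn_succ (f := g ∘ _), List.prod_cons]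
      simp [Function.comp_def]

theorem list_prod_reverse_ofFn_succ {M : Type*} [Monoid M] {n : ℕ} (g : Fin (n + 1) → M) :
    (List.ofFn g).reverse.prod =
      g (Fin.last n) * (List.ofFn (g ∘ Fin.castSucc)).reverse.prod := by
  rw [List.ofFn_succ', List.concat_eq_append, List.reverse_append]
  simp [Function.comp_def]

theorem list_prod_mul_of_anticomm {κ S : Type*} [Ring S] [Algebra ℂ S] {a b : κ → S}
    (h : ∀ i j, a i * b j + b j * a i = 0) {m : ℕ} (Y : Fin m → κ) (x : κ) :
    (List.ofFn fun i => a (Y i)).prod * b x =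
      (-1 : ℂ) ^ m • (b x * (List.ofFn fun i => a (Y i)).prod) := by
  induction m with
  | zero => simp
  | succ m ih =>
    rw [List.ofFn_succ, List.prod_cons, mul_assoc, ih, mul_smul_comm, ← mul_assoc,
      eq_neg_of_add_eq_zero_left (h (Y 0) x), pow_succ]
    simp [mul_assoc]

theorem list_prod_mul_list_prod_of_anticomm {κ S : Type*} [Ring S] [Algebra ℂ S] {a b : κ → S}
    (h : ∀ i j, a i * b j + b j * a i = 0) {m n : ℕ} (Y : Fin m → κ) (X : Fin n → κ) :
    (List.ofFn fun i => a (Y i)).prod * (List.ofFn fun i => b (X i)).prod =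
      (-1 : ℂ) ^ (m * n) •
        ((List.ofFn fun i => b (X i)).prod * (List.ofFn fun i => a (Y i)).prod) := by
  induction n with
  | zero => simp
  | succ n ih =>
    rw [List.ofFn_succ (n := n), List.prod_cons, ← mul_assoc, list_prod_mul_of_anticomm h,
      smul_mul_assoc, mul_assoc, ih, mul_smul_comm, smul_smul, mul_assoc, mul_add, pow_add, mul_one,
      mul_comm]

theorem list_reverse_ofFn_eq {α : Type*} {n : ℕ} (X : Fin n → α) :
    (List.ofFn X).reverse = List.ofFn (X ∘ Fin.rev) := by
  refine List.ext_getElem (by simp) fun i h₁ h₂ => ?_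
  simp only [List.getElem_reverse, List.getElem_ofFn, List.length_ofFn, Function.comp_apply]
  congr 1
  ext
  simp only [Fin.val_rev]
  omega

theorem annihilators_mul_creator {a adag : ι → R}
    (hcar1 : ∀ i j, a i * adag j + adag j * a i = if i = j then 1 else 0)
    {m : ℕ} (Y : Fin (m + 1) → ι) (x : ι) :
    (List.ofFn fun i => a (Y i)).prod * adag x =
      (-1 : ℂ) ^ (m + 1) • (adag x * (List.ofFn fun i => a (Y i)).prod) +
        ∑ j : Fin (m + 1), ((-1 : ℂ) ^ (m + (j : ℕ)) * if x = Y j then 1 else 0) •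
          (List.ofFn fun i => a (Y (j.succAbove i))).prod := by
  have swap : ∀ i, a i * adag x = -(adag x * a i) + (if x = i then (1 : ℂ) else 0) • (1 : R) := by
    intro i
    have := hcar1 i x
    rw [eq_sub_of_add_eq this]
    by_cases hi : i = x
    · simp [hi]; abel
    · simp [hi, Ne.symm hi]
  induction m with
  | zero => rw [Fin.sum_univ_one]; simp [swap]
  | succ m ih =>
    rw [List.ofFn_succ, List.prod_cons, mul_assoc, ih, mul_add, mul_smul_comm, ← mul_assoc,
      swap, Fin.sum_univ_succ (n := m + 1), Finset.mul_sum, add_mul, smul_add, add_assoc]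
    congr 1
    · simp [pow_succ, mul_assoc]
    congr 1
    · simp [mul_comm]
    · refine Finset.sum_congr rfl fun j _ => ?_
      rw [List.ofFn_succ (f := fun i => a (Y (j.succ.succAbove i))), List.prod_cons]
      simp only [mul_smul_comm, Fin.succ_succAbove_zero, Fin.succ_succAbove_succ, Fin.val_succ]
      congr 2
      ring

/-- The signed contribution of the contraction configuration `(π, π')` to the normal ordered form
of `a_{Y 1} ⋯ a_{Y m} · a⁺_{X n} ⋯ a⁺_{X 1}`. -/
def wickTerm (a adag : ι → R) {m n C : ℕ} (Y : Fin m → ι) (X : Fin n → ι)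
    (π : Fin C → Fin n) (π' : Fin C → Fin m) : R :=
  ((configSign π π' : ℂ) * ∏ c : Fin C, if X (π c) = Y (π' c) then (1 : ℂ) else 0) •
    ((List.ofFn fun i : Fin n => if ∃ c, π c = i then (1 : R) else adag (X i)).reverse.prod *
      (List.ofFn fun j : Fin m => if ∃ c, π' c = j then (1 : R) else a (Y j)).prod)

/-- The sum of the contributions of all contraction configurations of size `C` to the normal
ordered form of `a_{Y 1} ⋯ a_{Y m} · a⁺_{X n} ⋯ a⁺_{X 1}`. -/
def wickSum (a adag : ι → R) {m n : ℕ} (C : ℕ) (Y : Fin m → ι) (X : Fin n → ι) : R :=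
  ∑ π ∈ Finset.univ.filter (fun π : Fin C → Fin n => StrictAnti π),
    ∑ π' ∈ Finset.univ.filter (fun π' : Fin C → Fin m => Function.Injective π'),
      wickTerm a adag Y X π π'

theorem wickTerm_castSucc (a adag : ι → R) {m n C : ℕ} (Y : Fin m → ι) (X : Fin (n + 1) → ι)
    {π : Fin C → Fin n} {π' : Fin C → Fin m}
    (hπ : Function.Injective π) (hπ' : Function.Injective π') :
    wickTerm a adag Y X (Fin.castSucc ∘ π) π' =
      (-1 : ℂ) ^ m • (adag (X (Fin.last n)) * wickTerm a adag Y (X ∘ Fin.castSucc) π π') := by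
  have hlast : ¬ ∃ c, (Fin.castSucc ∘ π) c = Fin.last n := by
    rintro ⟨c, hc⟩; exact Fin.castSucc_ne_last _ hc
  rw [wickTerm, wickTerm, configSign_castSucc hπ hπ', list_prod_reverse_ofFn_succ, if_neg hlast,
    mul_smul_comm, smul_smul, mul_assoc]
  simp only [Function.comp_def, Fin.castSucc_inj, Int.cast_mul, Int.cast_pow, Int.cast_neg,
    Int.cast_one, mul_assoc]

theorem wickTerm_cons (a adag : ι → R) {m n C : ℕ} (Y : Fin (m + 1) → ι)
    (X : Fin (n + 1) → ι) {π : Fin C → Fin n} {π' : Fin C → Fin m}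
    (hπ : Function.Injective π) (hπ' : Function.Injective π') (j : Fin (m + 1)) :
    wickTerm a adag Y X (Fin.cons (Fin.last n) (Fin.castSucc ∘ π) : Fin (C + 1) → Fin (n + 1))
      (Fin.cons j (j.succAbove ∘ π') : Fin (C + 1) → Fin (m + 1)) =
      ((-1 : ℂ) ^ (m + (j : ℕ)) * if X (Fin.last n) = Y j then 1 else 0) •
        wickTerm a adag (Y ∘ j.succAbove) (X ∘ Fin.castSucc) π π' := by
  rw [wickTerm, wickTerm, configSign_cons hπ hπ', list_prod_reverse_ofFn_succ,
    list_prod_ofFn_eq_of_apply_eq_one (fun k => if ∃ c,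
      (Fin.cons j (j.succAbove ∘ π') : Fin (C + 1) → Fin (m + 1)) c = k then (1 : R) else a (Y k)) j
      (if_pos ⟨0, rfl⟩), if_pos ⟨0, rfl⟩, one_mul, smul_smul, Fin.prod_univ_succ]
  have hlast : ∀ i : Fin n, Fin.last n ≠ i.castSucc := fun i => (Fin.castSucc_ne_last i).symm
  have hj : ∀ i, j ≠ j.succAbove i := fun i => (Fin.succAbove_ne j i).symm
  congr 1
  · simp only [Fin.cons_zero, Fin.cons_succ, Function.comp_apply, Int.cast_mul, Int.cast_pow,
      Int.cast_neg, Int.cast_one]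
    ring
  · simp only [Function.comp_def, Fin.exists_fin_succ, Fin.cons_zero, Fin.cons_succ, hlast, hj,
      false_or, Fin.castSucc_inj, Fin.succAbove_right_inj]

theorem strictAnti_cons_last {n C : ℕ} {π : Fin C → Fin n} (hπ : StrictAnti π) :
    StrictAnti (Fin.cons (Fin.last n) (Fin.castSucc ∘ π) : Fin (C + 1) → Fin (n + 1)) := by
  intro c d h
  cases d using Fin.cases with
  | zero => exact absurd h (Fin.not_lt_zero _)
  | succ d =>
    cases c using Fin.cases with
    | zero => simp
    | succ c => simpa using hπ (Fin.succ_lt_succ_iff.1 h)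

theorem sum_strictAnti_succ {M : Type*} [AddCommMonoid M] {n C : ℕ}
    (F : (Fin (C + 1) → Fin (n + 1)) → M) :
    ∑ π ∈ Finset.univ.filter (fun π : Fin (C + 1) → Fin (n + 1) => StrictAnti π), F π =
      ∑ π ∈ Finset.univ.filter (fun π : Fin (C + 1) → Fin n => StrictAnti π),
        F (Fin.castSucc ∘ π) +
      ∑ π ∈ Finset.univ.filter (fun π : Fin C → Fin n => StrictAnti π),
        F (Fin.cons (Fin.last n) (Fin.castSucc ∘ π)) := by
  rw [← Finset.sum_filter_add_sum_filter_not _ (fun π => π 0 ≠ Fin.last n)]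
  congr 1
  · symm
    refine Finset.sum_bij (fun π _ => Fin.castSucc ∘ π) ?_ ?_ ?_ (fun _ _ => rfl)
    · intro π hπ
      simp only [Finset.mem_filter, Finset.mem_univ, true_and] at hπ ⊢
      exact ⟨fun c d h => hπ h, Fin.castSucc_ne_last _⟩
    · intro π _ ρ _ h
      exact (Fin.castSucc_injective n).comp_left h
    · intro ρ hρ
      simp only [Finset.mem_filter, Finset.mem_univ, true_and] at hρ
      have hne : ∀ c, ρ c ≠ Fin.last n := fun c hc => hρ.2 <|
        Fin.last_le_iff.1 (hc ▸ hρ.1.antitone (Fin.zero_le c))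
      refine ⟨fun c => (ρ c).castPred (hne c), ?_, ?_⟩
      · simp only [Finset.mem_filter, Finset.mem_univ, true_and]
        intro c d h
        exact Fin.castPred_lt_castPred_iff.2 (hρ.1 h)
      · ext c; simp
  · symm
    refine Finset.sum_bij (fun π _ => Fin.cons (Fin.last n) (Fin.castSucc ∘ π)) ?_ ?_ ?_
      (fun _ _ => rfl)
    · intro π hπ
      simp only [Finset.mem_filter, Finset.mem_univ, true_and] at hπ ⊢
      exact ⟨strictAnti_cons_last hπ, by simp⟩
    · intro π _ ρ _ h
      exact (Fin.castSucc_injective n).comp_left (Fin.cons_injective2 h).2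
    · intro ρ hρ
      simp only [Finset.mem_filter, Finset.mem_univ, true_and, not_not] at hρ
      have hne : ∀ c : Fin C, ρ c.succ ≠ Fin.last n := fun c hc =>
        (hρ.1.injective.ne (Fin.succ_ne_zero c)) (hc.trans hρ.2.symm)
      refine ⟨fun c => (ρ c.succ).castPred (hne c), ?_, ?_⟩
      · simp only [Finset.mem_filter, Finset.mem_univ, true_and]
        intro c d h
        exact Fin.castPred_lt_castPred_iff.2 (hρ.1 (Fin.succ_lt_succ_iff.2 h))
      · ext c
        cases c using Fin.cases with
        | zero => simp [hρ.2]
        | succ c => simp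

theorem sum_injective_succ {M : Type*} [AddCommMonoid M] {m C : ℕ}
    (F : (Fin (C + 1) → Fin (m + 1)) → M) :
    ∑ π ∈ Finset.univ.filter (fun π : Fin (C + 1) → Fin (m + 1) => Function.Injective π), F π =
      ∑ j : Fin (m + 1),
        ∑ π ∈ Finset.univ.filter (fun π : Fin C → Fin m => Function.Injective π),
          F (Fin.cons j (j.succAbove ∘ π)) := by
  symm
  rw [← Finset.sum_product' (f := fun j π => F (Fin.cons j (j.succAbove ∘ π)))]
  refine Finset.sum_bij (fun p _ => Fin.cons p.1 (p.1.succAbove ∘ p.2)) ?_ ?_ ?_ (fun _ _ => rfl)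
  · rintro ⟨j, π⟩ hp
    simp only [Finset.mem_product, Finset.mem_filter, Finset.mem_univ, true_and] at hp ⊢
    exact injective_cons_succAbove j hp
  · rintro ⟨j, π⟩ _ ⟨k, ρ⟩ _ h
    obtain ⟨rfl, h⟩ := Fin.cons_injective2 h
    exact congrArg (Prod.mk j) (Fin.succAbove_right_injective.comp_left h)
  · intro σ hσ
    obtain ⟨j, ρ, hρ, rfl⟩ := exists_eq_cons_succAbove (Finset.mem_filter.1 hσ).2
    exact ⟨(j, ρ), by simpa using hρ, rfl⟩

theorem wickSum_zero (a adag : ι → R) {m n : ℕ} (Y : Fin m → ι) (X : Fin n → ι) :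
    wickSum a adag 0 Y X = (-1 : ℂ) ^ (m * n) •
      ((List.ofFn fun i => adag (X i)).reverse.prod * (List.ofFn fun i => a (Y i)).prod) := by
  simp [wickSum, wickTerm, configSign, maxCrossPerm_zero, Finset.filter_true_of_mem,
    Function.injective_of_subsingleton, Subsingleton.strictAnti]

theorem wickSum_succ_succ (a adag : ι → R) {m n : ℕ} (C : ℕ) (Y : Fin (m + 1) → ι)
    (X : Fin (n + 1) → ι) :
    wickSum a adag (C + 1) Y X =
      (-1 : ℂ) ^ (m + 1) •
        (adag (X (Fin.last n)) * wickSum a adag (C + 1) Y (X ∘ Fin.castSucc)) +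
      ∑ j : Fin (m + 1), ((-1 : ℂ) ^ (m + (j : ℕ)) * if X (Fin.last n) = Y j then 1 else 0) •
        wickSum a adag C (Y ∘ j.succAbove) (X ∘ Fin.castSucc) := by
  simp only [wickSum]
  rw [sum_strictAnti_succ]
  congr 1
  · simp only [Finset.mul_sum, Finset.smul_sum]
    refine Finset.sum_congr rfl fun π hπ => Finset.sum_congr rfl fun π' hπ' => ?_
    exact wickTerm_castSucc a adag Y X (Finset.mem_filter.1 hπ).2.injective
      (Finset.mem_filter.1 hπ').2
  · simp only [Finset.smul_sum]
    simp only [sum_injective_succ]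
    rw [Finset.sum_comm]
    refine Finset.sum_congr rfl fun j _ => Finset.sum_congr rfl fun π hπ =>
      Finset.sum_congr rfl fun π' hπ' => ?_
    exact wickTerm_cons a adag Y X (Finset.mem_filter.1 hπ).2.injective
      (Finset.mem_filter.1 hπ').2 j

theorem wickSum_eq_zero (a adag : ι → R) {m n C : ℕ} (Y : Fin m → ι) (X : Fin n → ι)
    (h : min m n < C) : wickSum a adag C Y X = 0 := by
  refine Finset.sum_eq_zero fun π hπ => Finset.sum_eq_zero fun π' hπ' => ?_
  have h₁ : C ≤ n := by
    simpa using Fintype.card_le_of_injective π (Finset.mem_filter.1 hπ).2.injective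
  have h₂ : C ≤ m := by
    simpa using Fintype.card_le_of_injective π' (Finset.mem_filter.1 hπ').2
  omega

/-- **Wick's theorem** for a product of annihilation operators followed by creation operators. -/
theorem annihilators_mul_creators {a adag : ι → R}
    (hcar1 : ∀ i j, a i * adag j + adag j * a i = if i = j then 1 else 0) {n : ℕ} :
    ∀ {m : ℕ} (Y : Fin m → ι) (X : Fin n → ι) {N : ℕ}, min m n < N →
      (List.ofFn fun i => a (Y i)).prod * (List.ofFn fun i => adag (X i)).reverse.prod =
        ∑ C ∈ Finset.range N, wickSum a adag C Y X := by
  induction n with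
  | zero =>
    intro m Y X N hN
    obtain ⟨N, rfl⟩ := Nat.exists_eq_add_of_lt hN
    rw [Finset.sum_range_succ', Finset.sum_eq_zero, wickSum_zero]
    · simp
    · exact fun C _ => wickSum_eq_zero a adag Y X (by omega)
  | succ n ih =>
    intro m Y X N hN
    obtain ⟨N, rfl⟩ : ∃ k, N = k + 1 := ⟨N - 1, by omega⟩
    cases m with
    | zero =>
      rw [Finset.sum_range_succ', Finset.sum_eq_zero, wickSum_zero]
      · simp
      · exact fun C _ => wickSum_eq_zero a adag Y X (by omega)
    | succ m =>
      rw [Finset.sum_range_succ', wickSum_zero]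
      simp only [wickSum_succ_succ, Finset.sum_add_distrib]
      rw [list_prod_reverse_ofFn_succ, ← mul_assoc, annihilators_mul_creator hcar1, add_mul,
        smul_mul_assoc, mul_assoc, Finset.sum_mul, Finset.sum_comm]
      simp only [← Finset.smul_sum, ← Finset.mul_sum, smul_mul_assoc]
      have h₁ := ih Y (X ∘ Fin.castSucc) (N := N + 1) (by omega)
      have h₂ := fun j : Fin (m + 1) => ih (Y ∘ j.succAbove) (X ∘ Fin.castSucc) (N := N) (by omega)
      simp only [Function.comp_def] at h₁ h₂ ⊢
      rw [h₁, Finset.sum_range_succ', wickSum_zero, add_right_comm]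
      simp only [h₂, mul_add, smul_add, mul_smul_comm, smul_smul, mul_assoc, pow_add, mul_one]
      congr 3
      ring

theorem FAttachF_eq (a adag : ι → R) {nA mA nB mB : ℕ}
    (fA : ((Fin nA → ι) × (Fin mA → ι)) →₀ ℂ) (fB : ((Fin nB → ι) × (Fin mB → ι)) →₀ ℂ) :
    FAttachF a adag fA fB = fA.sum fun XYA cA => fB.sum fun XYB cB =>
      (cA * cB) • ((List.ofFn fun i => adag (XYA.1 i)).reverse.prod *
        (∑ C ∈ Finset.Icc 1 (min mA nB), wickSum a adag C XYA.2 XYB.1) *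
        (List.ofFn fun j => a (XYB.2 j)).prod) := by
  simp only [FAttachF, Finsupp.sum, wickSum, wickTerm, Finset.mul_sum, Finset.sum_mul,
    Finset.smul_sum]
  simp only [Finset.sum_comm (t := fB.support)]
  simp only [Finset.sum_comm (t := fA.support)]
  refine Finset.sum_congr rfl fun XYA _ => Finset.sum_congr rfl fun XYB _ =>
    Finset.sum_congr rfl fun C _ => Finset.sum_congr rfl fun π _ =>
    Finset.sum_congr rfl fun π' _ => ?_
  rw [mul_smul_comm, smul_mul_assoc, smul_smul]
  congr 1
  · ring
  · simp only [mul_assoc]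

/-- The contribution of the empty contraction to the product `Op(f_A) * Op(f_B)`. -/
def uncontractedProduct (a adag : ι → R) {nA mA nB mB : ℕ}
    (fA : ((Fin nA → ι) × (Fin mA → ι)) →₀ ℂ) (fB : ((Fin nB → ι) × (Fin mB → ι)) →₀ ℂ) : R :=
  fA.sum fun XYA cA => fB.sum fun XYB cB =>
    (cA * cB) • ((List.ofFn fun i => adag (XYA.1 i)).reverse.prod *
      wickSum a adag 0 XYA.2 XYB.1 * (List.ofFn fun j => a (XYB.2 j)).prod)

theorem FOp_mul_FOp {a adag : ι → R}
    (hcar1 : ∀ i j, a i * adag j + adag j * a i = if i = j then 1 else 0) {nA mA nB mB : ℕ}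
    (fA : ((Fin nA → ι) × (Fin mA → ι)) →₀ ℂ) (fB : ((Fin nB → ι) × (Fin mB → ι)) →₀ ℂ) :
    FOp a adag fA * FOp a adag fB =
      uncontractedProduct a adag fA fB + FAttachF a adag fA fB := by
  rw [FAttachF_eq, uncontractedProduct, FOp, FOp]
  simp only [Finsupp.sum, Finset.sum_mul_sum, ← Finset.sum_add_distrib]
  refine Finset.sum_congr rfl fun XYA _ => Finset.sum_congr rfl fun XYB _ => ?_
  have h := annihilators_mul_creators hcar1 XYA.2 XYB.1 (Nat.lt_succ_self _)
  rw [Finset.range_eq_Ico, Finset.sum_eq_sum_Ico_succ_bot (Nat.succ_pos _)] at h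
  rw [smul_mul_smul_comm, ← smul_add, ← add_mul, ← mul_add]
  have hI : Finset.Icc 1 (min mA nB) = Finset.Ico (0 + 1) (min mA nB).succ := by
    ext; simp only [Finset.mem_Icc, Finset.mem_Ico]; omega
  rw [hI, ← h]
  simp only [mul_assoc]

theorem uncontractedProduct_add_swap {a adag : ι → R}
    (hcar2 : ∀ i j, a i * a j + a j * a i = 0)
    (hcar3 : ∀ i j, adag i * adag j + adag j * adag i = 0)
    {nA mA nB mB : ℕ} (hpar : Odd ((nA + mA) * (nB + mB)))
    (fA : ((Fin nA → ι) × (Fin mA → ι)) →₀ ℂ) (fB : ((Fin nB → ι) × (Fin mB → ι)) →₀ ℂ) :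
    uncontractedProduct a adag fA fB + uncontractedProduct a adag fB fA = 0 := by
  rw [uncontractedProduct, uncontractedProduct, Finsupp.sum_comm fB fA]
  simp only [Finsupp.sum, ← Finset.sum_add_distrib, wickSum_zero]
  refine Finset.sum_eq_zero fun XYA _ => Finset.sum_eq_zero fun XYB _ => ?_
  have hc := list_prod_mul_list_prod_of_anticomm hcar3 (XYB.1 ∘ Fin.rev) (XYA.1 ∘ Fin.rev)
  have hann := list_prod_mul_list_prod_of_anticomm hcar2 XYB.2 XYA.2
  simp only [list_reverse_ofFn_eq, Function.comp_def] at hc ⊢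
  set cA := (List.ofFn fun i => adag (XYA.1 i.rev)).prod
  set cB := (List.ofFn fun i => adag (XYB.1 i.rev)).prod
  set dA := (List.ofFn fun i => a (XYA.2 i)).prod
  set dB := (List.ofFn fun i => a (XYB.2 i)).prod
  have hsign : (-1 : ℂ) ^ (mB * nA) * ((-1) ^ (nB * nA) * (-1) ^ (mB * mA)) =
      -(-1) ^ (mA * nB) := by
    have h := hpar.neg_one_pow (α := ℂ)
    have hsq : ((-1 : ℂ) ^ (mA * nB)) * (-1) ^ (mA * nB) = 1 := by
      rw [← mul_pow]; simp
    rw [show (nA + mA) * (nB + mB) = mB * nA + nB * nA + mB * mA + mA * nB by ring, pow_add,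
      pow_add, pow_add] at h
    linear_combination (-1 : ℂ) ^ (mA * nB) * h -
      (-1 : ℂ) ^ (mB * nA) * ((-1) ^ (nB * nA) * (-1) ^ (mB * mA)) * hsq
  have hswap : cB * (cA * dB) * dA =
      ((-1 : ℂ) ^ (nB * nA) * (-1) ^ (mB * mA)) • (cA * (cB * dA) * dB) := by
    calc cB * (cA * dB) * dA = (cB * cA) * (dB * dA) := by simp only [mul_assoc]
      _ = _ := by rw [hc, hann, smul_mul_smul_comm]; simp only [mul_assoc]
  rw [mul_smul_comm, smul_mul_assoc, mul_smul_comm, smul_mul_assoc, hswap]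
  simp only [smul_smul, ← add_smul]
  rw [show fA XYA * fB XYB * (-1) ^ (mA * nB) + fB XYB * fA XYA *
      ((-1) ^ (mB * nA) * ((-1) ^ (nB * nA) * (-1) ^ (mB * mA))) = 0 by
    linear_combination fB XYB * fA XYA * hsign, zero_smul]

/-- **Fermionic anticommutator formula** (Theorem 3.2, odd case, discrete-mode form):
if `a, a⁺` satisfy the CAR and `(n_A + m_A)(n_B + m_B)` is odd, then
`{Op(f_A), Op(f_B)} = Op(f_A) Γ₋ Op(f_B) + Op(f_B) Γ₋ Op(f_A)`. -/
theorem fermionic_anticommutator_formula (a adag : ι → R)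
    (hcar1 : ∀ i j, a i * adag j + adag j * a i = if i = j then 1 else 0)
    (hcar2 : ∀ i j, a i * a j + a j * a i = 0)
    (hcar3 : ∀ i j, adag i * adag j + adag j * adag i = 0)
    {nA mA nB mB : ℕ} (hpar : Odd ((nA + mA) * (nB + mB)))
    (fA : ((Fin nA → ι) × (Fin mA → ι)) →₀ ℂ)
    (fB : ((Fin nB → ι) × (Fin mB → ι)) →₀ ℂ) :
    FOp a adag fA * FOp a adag fB + FOp a adag fB * FOp a adag fA =
      FAttachF a adag fA fB + FAttachF a adag fB fA := by
  rw [FOp_mul_FOp hcar1, FOp_mul_FOp hcar1, add_add_add_comm,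
    uncontractedProduct_add_swap hcar2 hcar3 hpar, zero_add]
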